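/- arXiv:2505.19527 — 4 statements merged into one kernel-verified Lean document; each statement's English description precedes it below -/
import Mathlib

section
/- Let φ : ℝ^d → ℝ be a continuous bounded function. Then the family of functions θ ↦ φ_ρ(θ) − ρ converges locally uniformly on ℝ^d to the constant function sup φ as ρ → +∞ (convergence along the filter ρ → +∞). -/
noncomputable section

/-- The `ρ`-offset function of `ψ : ℝ^d → ℝ`:
`ψ_ρ(θ) = sup { y : ∃ θ', ‖θ' − θ‖² + (y − ψ(θ'))² < ρ² }`. -/
def offsetFun {d : ℕ} (ψ : EuclideanSpace ℝ (Fin d) → ℝ) (ρ : ℝ)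
    (θ : EuclideanSpace ℝ (Fin d)) : ℝ :=
  sSup { y : ℝ | ∃ θ' : EuclideanSpace ℝ (Fin d), ‖θ' - θ‖ ^ 2 + (y - ψ θ') ^ 2 < ρ ^ 2 }

/-- Every height attained in the `ρ`-offset of a function bounded by `S` is at most `S + ρ`. -/
theorem mem_upperBounds_offset {d : ℕ} {ψ : EuclideanSpace ℝ (Fin d) → ℝ} {S ρ : ℝ}
    (hS : ∀ θ, ψ θ ≤ S) (hρ : 0 ≤ ρ) (θ : EuclideanSpace ℝ (Fin d)) :
    S + ρ ∈ upperBounds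
      { y : ℝ | ∃ θ' : EuclideanSpace ℝ (Fin d), ‖θ' - θ‖ ^ 2 + (y - ψ θ') ^ 2 < ρ ^ 2 } := by
  rintro y ⟨θ', h⟩
  have hy : y - ψ θ' < ρ := lt_of_pow_lt_pow_left₀ 2 hρ (by nlinarith [sq_nonneg ‖θ' - θ‖])
  linarith [hS θ']

theorem offsetFun_le {d : ℕ} {ψ : EuclideanSpace ℝ (Fin d) → ℝ} {S ρ : ℝ}
    (hS : ∀ θ, ψ θ ≤ S) (hρ : 0 < ρ) (θ : EuclideanSpace ℝ (Fin d)) :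
    offsetFun ψ ρ θ ≤ S + ρ :=
  csSup_le ⟨ψ θ, θ, by simpa using pow_pos hρ 2⟩ (mem_upperBounds_offset hS hρ.le θ)

theorem le_offsetFun {d : ℕ} {ψ : EuclideanSpace ℝ (Fin d) → ℝ} {S ρ y : ℝ}
    (hS : ∀ θ, ψ θ ≤ S) (hρ : 0 ≤ ρ) {θ θ' : EuclideanSpace ℝ (Fin d)}
    (h : ‖θ' - θ‖ ^ 2 + (y - ψ θ') ^ 2 < ρ ^ 2) : y ≤ offsetFun ψ ρ θ :=
  le_csSup ⟨_, mem_upperBounds_offset hS hρ θ⟩ ⟨θ', h⟩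

/-- **Weak ironing (locally uniform version).**
For a continuous bounded `φ : ℝ^d → ℝ`, the family `θ ↦ φ_ρ(θ) − ρ` converges
locally uniformly on `ℝ^d` to the constant `sup φ` as `ρ → +∞`. -/
theorem weak_ironing_locally_uniform {d : ℕ}
    (φ : EuclideanSpace ℝ (Fin d) → ℝ)
    (hcont : Continuous φ) (hbdd : ∃ M : ℝ, ∀ θ, |φ θ| ≤ M) :
    TendstoLocallyUniformly (fun ρ θ => offsetFun φ ρ θ - ρ)
      (fun _ => sSup (Set.range φ)) Filter.atTop := by
  obtain ⟨M, hM⟩ := hbdd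
  have hbdd : BddAbove (Set.range φ) :=
    ⟨M, Set.forall_mem_range.2 fun θ => (le_abs_self _).trans (hM θ)⟩
  have hS : ∀ θ, φ θ ≤ sSup (Set.range φ) := fun θ => le_csSup hbdd ⟨θ, rfl⟩
  rw [Metric.tendstoLocallyUniformly_iff]
  intro ε hε θ₀
  obtain ⟨_, ⟨θ', rfl⟩, hθ'⟩ :=
    exists_lt_of_lt_csSup (Set.range_nonempty φ) (sub_lt_self (sSup (Set.range φ)) (half_pos hε))
  refine ⟨Metric.ball θ₀ 1, Metric.ball_mem_nhds _ one_pos, ?_⟩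
  filter_upwards [Filter.eventually_gt_atTop 0,
    Filter.eventually_gt_atTop (((dist θ' θ₀ + 1) ^ 2 + ε ^ 2 / 4) / ε)] with ρ hρ hρε θ hθ
  rw [div_lt_iff₀ hε] at hρε
  have hdist : ‖θ' - θ‖ ≤ dist θ' θ₀ + 1 := by
    rw [← dist_eq_norm]
    linarith [dist_triangle_right θ' θ θ₀, Metric.mem_ball.1 hθ]
  have hsq : ‖θ' - θ‖ ^ 2 ≤ (dist θ' θ₀ + 1) ^ 2 := by gcongr
  have hlower : φ θ' + ρ - ε / 2 ≤ offsetFun φ ρ θ :=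
    le_offsetFun (θ' := θ') hS hρ.le (by nlinarith)
  have hupper := offsetFun_le hS hρ θ
  rw [Real.dist_eq, abs_lt]
  constructor <;> linarith
end
end

section
/- Let φ : ℝ^d → ℝ be a continuous bounded function with graph Γ(φ), and let ρ > 0. Then for every θ ∈ ℝ^d, the Euclidean distance in ℝ^d × ℝ from the point (θ, φ_ρ(θ)) to the set Γ(φ) equals exactly ρ; that is, inf{ ‖(θ, φ_ρ(θ)) − (θ', φ(θ'))‖ : θ' ∈ ℝ^d } = ρ. -/
open scoped RealInnerProductSpace

noncomputable section

/-- The ambient space `ℝ^d × ℝ` equipped with the Euclidean (L²) norm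
`‖(θ, y)‖ = √(‖θ‖² + y²)`. -/
abbrev EucProd (d : ℕ) := WithLp 2 (EuclideanSpace ℝ (Fin d) × ℝ)

/-- The point `(θ, y)` of `ℝ^d × ℝ`. -/
def pt {d : ℕ} (θ : EuclideanSpace ℝ (Fin d)) (y : ℝ) : EucProd d :=
  (WithLp.equiv 2 (EuclideanSpace ℝ (Fin d) × ℝ)).symm (θ, y)

/-- The graph `Γ(ψ) = {(θ, ψ(θ))} ⊆ ℝ^d × ℝ` of `ψ`. -/
def graphOf {d : ℕ} (ψ : EuclideanSpace ℝ (Fin d) → ℝ) : Set (EucProd d) :=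
  { p | ∃ θ, p = pt θ (ψ θ) }

theorem dist_pt {d : ℕ} (θ θ' : EuclideanSpace ℝ (Fin d)) (y y' : ℝ) :
    dist (pt θ y) (pt θ' y') = √(‖θ' - θ‖ ^ 2 + (y - y') ^ 2) := by
  rw [WithLp.prod_dist_eq_of_L2]
  simp [pt, dist_eq_norm, norm_sub_rev θ θ']

/-- The set of heights over `θ` at distance less than `ρ` from the graph of `ψ`. -/
def offsetHeights {d : ℕ} (ψ : EuclideanSpace ℝ (Fin d) → ℝ) (ρ : ℝ)
    (θ : EuclideanSpace ℝ (Fin d)) : Set ℝ :=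
  { y : ℝ | ∃ θ' : EuclideanSpace ℝ (Fin d), ‖θ' - θ‖ ^ 2 + (y - ψ θ') ^ 2 < ρ ^ 2 }

theorem isOpen_offsetHeights {d : ℕ} (ψ : EuclideanSpace ℝ (Fin d) → ℝ) (ρ : ℝ)
    (θ : EuclideanSpace ℝ (Fin d)) : IsOpen (offsetHeights ψ ρ θ) := by
  simp only [offsetHeights, Set.ofPred_exists]
  exact isOpen_iUnion fun θ' => isOpen_lt (by fun_prop) continuous_const

theorem isLUB_offsetFun {d : ℕ} {ψ : EuclideanSpace ℝ (Fin d) → ℝ} {M : ℝ}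
    (hM : ∀ θ, |ψ θ| ≤ M) {ρ : ℝ} (hρ : 0 < ρ) (θ : EuclideanSpace ℝ (Fin d)) :
    IsLUB (offsetHeights ψ ρ θ) (offsetFun ψ ρ θ) := by
  refine isLUB_csSup ⟨ψ θ, θ, by simpa using pow_pos hρ 2⟩ ⟨M + ρ, ?_⟩
  rintro y ⟨θ', h⟩
  have h₁ : y - ψ θ' < ρ := lt_of_pow_lt_pow_left₀ 2 hρ.le (by nlinarith [sq_nonneg ‖θ' - θ‖])
  linarith [(abs_le.mp (hM θ')).2]

theorem offsetFun_notMem_offsetHeights {d : ℕ} {ψ : EuclideanSpace ℝ (Fin d) → ℝ} {M : ℝ}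
    (hM : ∀ θ, |ψ θ| ≤ M) {ρ : ℝ} (hρ : 0 < ρ) (θ : EuclideanSpace ℝ (Fin d)) :
    offsetFun ψ ρ θ ∉ offsetHeights ψ ρ θ := by
  intro hmem
  obtain ⟨ε, hε, hball⟩ := Metric.isOpen_iff.mp (isOpen_offsetHeights ψ ρ θ) _ hmem
  have hle := (isLUB_offsetFun hM hρ θ).1 (hball (a := offsetFun ψ ρ θ + ε / 2) (by
    rw [Metric.mem_ball, Real.dist_eq, add_sub_cancel_left, abs_of_pos (half_pos hε)]
    exact half_lt_self hε))
  linarith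

/-- For continuous bounded `φ` and `ρ > 0`, the Euclidean distance in `ℝ^d × ℝ`
from the point `(θ, φ_ρ(θ))` to the graph of `φ` is exactly `ρ`. -/
theorem infDist_offset_graph {d : ℕ}
    (φ : EuclideanSpace ℝ (Fin d) → ℝ)
    (hcont : Continuous φ) (hbdd : ∃ M : ℝ, ∀ θ, |φ θ| ≤ M)
    (ρ : ℝ) (hρ : 0 < ρ) (θ : EuclideanSpace ℝ (Fin d)) :
    Metric.infDist (pt θ (offsetFun φ ρ θ)) (graphOf φ) = ρ := by
  obtain ⟨M, hM⟩ := hbdd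
  apply le_antisymm
  · refine le_of_forall_pos_le_add fun ε hε => ?_
    have hlub := isLUB_offsetFun hM hρ θ
    obtain ⟨y, hy, hlt, hle⟩ := hlub.exists_between (sub_lt_self _ hε)
    obtain ⟨θ', h⟩ := hy
    have h₁ : dist (pt θ (offsetFun φ ρ θ)) (pt θ y) ≤ ε := by
      rw [dist_pt, sub_self, norm_zero, zero_pow two_ne_zero, zero_add,
        Real.sqrt_sq (by linarith)]
      linarith
    have h₂ : dist (pt θ y) (pt θ' (φ θ')) ≤ ρ := by
      rw [dist_pt]
      exact Real.sqrt_le_iff.mpr ⟨hρ.le, h.le⟩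
    calc Metric.infDist (pt θ (offsetFun φ ρ θ)) (graphOf φ)
        ≤ dist (pt θ (offsetFun φ ρ θ)) (pt θ' (φ θ')) :=
          Metric.infDist_le_dist_of_mem ⟨θ', rfl⟩
      _ ≤ dist (pt θ (offsetFun φ ρ θ)) (pt θ y) + dist (pt θ y) (pt θ' (φ θ')) :=
          dist_triangle _ _ _
      _ ≤ ρ + ε := by linarith
  · have hne : (graphOf φ).Nonempty := ⟨pt θ (φ θ), θ, rfl⟩
    refine (Metric.le_infDist hne).mpr ?_
    rintro _ ⟨θ', rfl⟩
    rw [dist_pt]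
    refine Real.le_sqrt_of_sq_le (not_lt.mp fun h => ?_)
    exact offsetFun_notMem_offsetHeights hM hρ θ ⟨θ', h⟩
end
end

section
/- Let f : ℝ^d → ℝ be a twice continuously differentiable (C²) function with graph Γ, let θ₀ ∈ ℝ^d be a local minimum of f, set p = (θ₀, f(θ₀)) ∈ Γ, and let σ = ‖Hess f(θ₀)‖ be the operator norm of the Hessian of f at θ₀ (the sharpness at p), assumed positive. Then for every ρ > 1/σ, the point p is ρ-unreachable. -/
open scoped RealInnerProductSpace

noncomputable section

/-- The epigraph of `f` as a subset of `ℝ^d × ℝ`. -/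
def epiOf {d : ℕ} (f : EuclideanSpace ℝ (Fin d) → ℝ) : Set (EucProd d) :=
  { c | f ((WithLp.equiv 2 (EuclideanSpace ℝ (Fin d) × ℝ)) c).1
      ≤ ((WithLp.equiv 2 (EuclideanSpace ℝ (Fin d) × ℝ)) c).2 }

/-- A point `p` of the graph of `f` is `ρ`-unreachable iff every center
`c ∈ epi f` with `‖c − p‖ = ρ` satisfies `‖c − q‖ < ρ` for some `q` on the
graph of `f`. -/
def Unreachable {d : ℕ} (f : EuclideanSpace ℝ (Fin d) → ℝ) (ρ : ℝ)
    (p : EucProd d) : Prop :=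
  ∀ c ∈ epiOf f, ‖c - p‖ = ρ → ∃ q ∈ graphOf f, ‖c - q‖ < ρ

/-- Second-order necessary condition for a local minimum of a function of one variable. -/
theorem IsLocalMin.second_deriv_nonneg {φ φ' : ℝ → ℝ} {x c : ℝ} (hmin : IsLocalMin φ x)
    (hφ : ∀ t, HasDerivAt φ (φ' t) t) (hφ' : HasDerivAt φ' c x) : 0 ≤ c := by
  by_contra! hc
  have hd : deriv φ = φ' := funext fun t => (hφ t).deriv
  have hmax : IsLocalMax φ x :=
    isLocalMax_of_deriv_deriv_neg (by rwa [hd, hφ'.deriv]) hmin.deriv_eq_zero (hφ x).continuousAt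
  have hconst : φ =ᶠ[nhds x] fun _ => φ x := by
    filter_upwards [hmin, hmax] with t h₁ h₂ using le_antisymm h₂ h₁
  have hzero : φ' =ᶠ[nhds x] fun _ => 0 := by
    simpa [hd] using hconst.deriv
  have : c = 0 := by rw [← hφ'.deriv, hzero.deriv_eq, deriv_const]
  exact hc.ne this

section Hessian

variable {E : Type*} [NormedAddCommGroup E] [NormedSpace ℝ E] {f : E → ℝ}

theorem hasDerivAt_comp_line (hf : Differentiable ℝ f) (x v : E) (t : ℝ) :
    HasDerivAt (fun s : ℝ => f (x + s • v)) (fderiv ℝ f (x + t • v) v) t := by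
  have hline : HasDerivAt (fun s : ℝ => x + s • v) v t := by
    simpa using ((hasDerivAt_id t).smul_const v).const_add x
  exact (hf _).hasFDerivAt.comp_hasDerivAt t hline

theorem hasDerivAt_fderiv_comp_line (hf : ContDiff ℝ 2 f) (x v : E) :
    HasDerivAt (fun s : ℝ => fderiv ℝ f (x + s • v) v) (fderiv ℝ (fderiv ℝ f) x v v) 0 := by
  have hline : HasDerivAt (fun s : ℝ => x + s • v) v 0 := by
    simpa using ((hasDerivAt_id (0 : ℝ)).smul_const v).const_add x
  have hdiff : Differentiable ℝ (fderiv ℝ f) :=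
    (hf.fderiv_right (m := 1) (by norm_num)).differentiable (by norm_num)
  have h : HasDerivAt (fun s : ℝ => fderiv ℝ f (x + s • v)) (fderiv ℝ (fderiv ℝ f) x v) 0 :=
    (hdiff x).hasFDerivAt.comp_hasDerivAt_of_eq 0 hline (by simp)
  simpa using h.clm_apply (hasDerivAt_const 0 v)

theorem IsLocalMin.comp_line {x : E} (hmin : IsLocalMin f x) (v : E) :
    IsLocalMin (fun s : ℝ => f (x + s • v)) 0 := by
  have hcont : Continuous fun s : ℝ => x + s • v := by fun_prop
  exact IsLocalMin.comp_continuous (g := fun s : ℝ => x + s • v) (b := 0)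
    (by simpa using hmin) hcont.continuousAt

theorem IsLocalMin.fderiv_fderiv_nonneg {x : E} (hmin : IsLocalMin f x) (hf : ContDiff ℝ 2 f)
    (v : E) : 0 ≤ fderiv ℝ (fderiv ℝ f) x v v :=
  (hmin.comp_line v).second_deriv_nonneg
    (hasDerivAt_comp_line (hf.differentiable (by norm_num)) x v) (hasDerivAt_fderiv_comp_line hf x v)

/-- A symmetric positive semidefinite bilinear form is bounded by any bound on its
quadratic form. -/
theorem ContinuousLinearMap.opNorm_le_of_quadratic_le {B : E →L[ℝ] E →L[ℝ] ℝ} {K : ℝ}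
    (hK : 0 ≤ K) (hsymm : ∀ v w, B v w = B w v) (hnonneg : ∀ v, 0 ≤ B v v)
    (hle : ∀ v, B v v ≤ K * ‖v‖ ^ 2) : ‖B‖ ≤ K := by
  refine B.opNorm_le_bound₂ hK fun v w => abs_le_of_sq_le_sq ?_ (by positivity)
  have hcs : B v w ^ 2 ≤ B v v * B w w := by
    have h := discrim_le_zero (a := B w w) (b := 2 * B v w) (c := B v v) fun t => by
      have := hnonneg (v + t • w)
      simp only [map_add, map_smul, add_apply, smul_apply, smul_eq_mul, hsymm w v] at this
      linarith
    unfold discrim at h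
    linarith
  calc B v w ^ 2 ≤ B v v * B w w := hcs
    _ ≤ (K * ‖v‖ ^ 2) * (K * ‖w‖ ^ 2) :=
        mul_le_mul (hle v) (hle w) (hnonneg w) (by positivity)
    _ = (K * ‖v‖ * ‖w‖) ^ 2 := by ring

end Hessian

theorem norm_sub_pt_sq {d : ℕ} (c : EucProd d) (θ : EuclideanSpace ℝ (Fin d)) (y : ℝ) :
    ‖c - pt θ y‖ ^ 2 = ‖θ - c.fst‖ ^ 2 + (y - c.snd) ^ 2 := by
  rw [WithLp.prod_norm_sq_eq_of_L2, norm_sub_rev θ, ← sq_abs (y - c.snd), abs_sub_comm]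
  rfl

section Ball

variable {E : Type*} [NormedAddCommGroup E] [InnerProductSpace ℝ E] {f : E → ℝ} {θ₀ a : E} {b : ℝ}

/-- If the graph of `f` has a horizontal tangent plane at its point nearest to `(a, b)`, then
`(a, b)` lies on the vertical line through that point. -/
theorem fst_eq_of_isLocalMin_dist_sq (hf : Differentiable ℝ f) (hcrit : fderiv ℝ f θ₀ = 0)
    (hdist : IsLocalMin (fun θ => ‖θ - a‖ ^ 2 + (f θ - b) ^ 2) θ₀) : θ₀ = a := by
  have h₁ : HasFDerivAt f (0 : E →L[ℝ] ℝ) θ₀ := hcrit ▸ (hf θ₀).hasFDerivAt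
  have h₂ := (((hasFDerivAt_id θ₀).sub_const a).norm_sq).add ((h₁.sub_const b).pow 2)
  have h₃ := congrArg (fun L : E →L[ℝ] ℝ => L (θ₀ - a)) (hdist.hasFDerivAt_eq_zero h₂)
  have h₄ : ⟪θ₀ - a, θ₀ - a⟫ = 0 := by
    rw [inner_sub_left]
    simpa using h₃
  exact sub_eq_zero.1 (inner_self_eq_zero.1 h₄)

/-- Second-order necessary condition for `(θ₀, f θ₀)` to be a point of the graph of `f` nearest
to a point on the vertical line through it. -/
theorem mul_fderiv_fderiv_le_of_isLocalMin_dist_sq (hf : ContDiff ℝ 2 f)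
    (hcrit : fderiv ℝ f θ₀ = 0)
    (hdist : IsLocalMin (fun θ => ‖θ - θ₀‖ ^ 2 + (f θ - b) ^ 2) θ₀) (v : E) :
    (b - f θ₀) * fderiv ℝ (fderiv ℝ f) θ₀ v v ≤ ‖v‖ ^ 2 := by
  set φ : ℝ → ℝ := fun s => f (θ₀ + s • v)
  set φ' : ℝ → ℝ := fun s => fderiv ℝ f (θ₀ + s • v) v
  have hφ : ∀ t, HasDerivAt φ (φ' t) t :=
    hasDerivAt_comp_line (hf.differentiable (by norm_num)) θ₀ v
  have hφ' : HasDerivAt φ' (fderiv ℝ (fderiv ℝ f) θ₀ v v) 0 := hasDerivAt_fderiv_comp_line hf θ₀ v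
  have hmin : IsLocalMin (fun s : ℝ => s ^ 2 * ‖v‖ ^ 2 + (φ s - b) ^ 2) 0 := by
    simpa [norm_smul, mul_pow] using hdist.comp_line v
  have hd : ∀ t, HasDerivAt (fun s : ℝ => s ^ 2 * ‖v‖ ^ 2 + (φ s - b) ^ 2)
      (2 * t * ‖v‖ ^ 2 + 2 * (φ t - b) * φ' t) t := fun t =>
    (((hasDerivAt_pow 2 t).mul_const (‖v‖ ^ 2)).fun_add
      (((hφ t).sub_const b).fun_pow 2)).congr_deriv (by simp)
  have hdd := ((((hasDerivAt_id (0 : ℝ)).const_mul 2).mul_const (‖v‖ ^ 2)).add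
    ((((hφ 0).sub_const b).const_mul 2).mul hφ'))
  have h := hmin.second_deriv_nonneg hd hdd
  have h0 : φ 0 = f θ₀ := by simp [φ]
  have h0' : φ' 0 = 0 := by simp [φ', hcrit]
  rw [h0, h0'] at h
  linarith

end Ball

/-- **Unreachable sharp minima.** If `f` is `C²`, `θ₀` is a local minimum of `f`
and `σ = ‖Hess f(θ₀)‖ > 0`, then for every `ρ > 1/σ` the point
`p = (θ₀, f(θ₀))` of the graph of `f` is `ρ`-unreachable. -/
theorem unreachable_sharp_minima {d : ℕ}
    (f : EuclideanSpace ℝ (Fin d) → ℝ) (hf : ContDiff ℝ 2 f)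
    (θ₀ : EuclideanSpace ℝ (Fin d)) (hmin : IsLocalMin f θ₀)
    (hσ : 0 < ‖fderiv ℝ (fderiv ℝ f) θ₀‖) :
    ∀ ρ : ℝ, 1 / ‖fderiv ℝ (fderiv ℝ f) θ₀‖ < ρ →
      Unreachable f ρ (pt θ₀ (f θ₀)) := by
  intro ρ hρ c hc hcρ
  have hρ0 : 0 < ρ := (one_div_pos.2 hσ).trans hρ
  by_contra! hfar
  have hcrit : fderiv ℝ f θ₀ = 0 := hmin.fderiv_eq_zero
  have heq : ‖θ₀ - c.fst‖ ^ 2 + (f θ₀ - c.snd) ^ 2 = ρ ^ 2 := by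
    rw [← norm_sub_pt_sq, hcρ]
  have hdist : IsLocalMin (fun θ => ‖θ - c.fst‖ ^ 2 + (f θ - c.snd) ^ 2) θ₀ :=
    Filter.Eventually.of_forall fun θ => by
      beta_reduce
      rw [heq, ← norm_sub_pt_sq]
      exact pow_le_pow_left₀ hρ0.le (hfar _ ⟨θ, rfl⟩) 2
  have hfst := fst_eq_of_isLocalMin_dist_sq (hf.differentiable (by norm_num)) hcrit hdist
  have hepi : f c.fst ≤ c.snd := hc
  rw [← hfst] at heq hdist hepi
  have hsnd : c.snd - f θ₀ = ρ := by
    rw [← sq_eq_sq₀ (sub_nonneg.2 hepi) hρ0.le, ← heq]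
    simp only [sub_self, norm_zero]
    ring
  have hle : ‖fderiv ℝ (fderiv ℝ f) θ₀‖ ≤ 1 / ρ := by
    refine ContinuousLinearMap.opNorm_le_of_quadratic_le (by positivity)
      (hf.contDiffAt.isSymmSndFDerivAt (by simp)) (hmin.fderiv_fderiv_nonneg hf) fun v => ?_
    have h := mul_fderiv_fderiv_le_of_isLocalMin_dist_sq hf hcrit hdist v
    rw [hsnd] at h
    rw [one_div_mul_eq_div, le_div_iff₀' hρ0]
    exact h
  exact hρ.not_ge ((le_one_div hρ0 hσ).2 hle)
end
end

section
/- Let f : ℝ^d → ℝ be a continuous function with graph Γ and let ρ > 0. If a point p ∈ Γ is ρ-unreachable, then there exists ε > 0 such that every point of B(p, ε) ∩ Γ is ρ-unreachable; equivalently, the set of ρ-unreachable points is open in the subspace topology of Γ. -/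
open scoped RealInnerProductSpace

noncomputable section

theorem isClosed_epiOf {d : ℕ} {f : EuclideanSpace ℝ (Fin d) → ℝ} (hf : Continuous f) :
    IsClosed (epiOf f) :=
  isClosed_le (hf.comp (continuous_fst.comp (WithLp.prod_continuous_ofLp 2 _ _)))
    (continuous_snd.comp (WithLp.prod_continuous_ofLp 2 _ _))

/-- If every translate `p + v` with `‖v‖ = ρ` lies in the open set `W`, then the same holds for
all points near `p`. -/
theorem eventually_forall_sphere_mem {E : Type*} [NormedAddCommGroup E] [ProperSpace E]
    {W : Set E} (hW : IsOpen W) {ρ : ℝ} {p : E} (h : ∀ c, ‖c - p‖ = ρ → c ∈ W) :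
    ∀ᶠ q in nhds p, ∀ c, ‖c - q‖ = ρ → c ∈ W := by
  have key : ∀ᶠ q in nhds p, ∀ v ∈ Metric.sphere (0 : E) ρ, q + v ∈ W := by
    refine (isCompact_sphere (0 : E) ρ).eventually_forall_of_forall_eventually fun v hv => ?_
    have hmem : p + v ∈ W := h _ (by simpa using hv)
    exact continuous_add.continuousAt.eventually (hW.mem_nhds hmem)
  filter_upwards [key] with q hq c hc
  simpa using hq (c - q) (by simpa using hc)

/-- **Non-isolated unreachable points.** For continuous `f` and `ρ > 0`, if
`p ∈ Γ` is `ρ`-unreachable then there is `ε > 0` such that every point of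
`B(p, ε) ∩ Γ` is `ρ`-unreachable; i.e. the set of `ρ`-unreachable points is
open in `Γ`. -/
theorem unreachable_isOpen {d : ℕ}
    (f : EuclideanSpace ℝ (Fin d) → ℝ) (hf : Continuous f)
    (ρ : ℝ) (hρ : 0 < ρ) (p : EucProd d) (hp : p ∈ graphOf f)
    (hunr : Unreachable f ρ p) :
    ∃ ε > (0 : ℝ), ∀ q ∈ Metric.ball p ε ∩ graphOf f, Unreachable f ρ q := by
  have hopen : IsOpen ((epiOf f)ᶜ ∪ ⋃ q ∈ graphOf f, Metric.ball q ρ) :=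
    (isClosed_epiOf hf).isOpen_compl.union (isOpen_biUnion fun _ _ => Metric.isOpen_ball)
  have hev := eventually_forall_sphere_mem (ρ := ρ) (p := p) hopen fun c hc => by
    by_cases hce : c ∈ epiOf f
    · obtain ⟨q, hq, hcq⟩ := hunr c hce hc
      exact Or.inr (Set.mem_biUnion hq (mem_ball_iff_norm.2 hcq))
    · exact Or.inl hce
  obtain ⟨ε, hε, hball⟩ := Metric.eventually_nhds_iff_ball.1 hev
  refine ⟨ε, hε, fun q hq c hce hc => ?_⟩
  rcases hball q hq.1 c hc with hnot | hmem
  · exact absurd hce hnot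
  · obtain ⟨q', hq', hcq'⟩ := Set.mem_iUnion₂.1 hmem
    exact ⟨q', hq', mem_ball_iff_norm.1 hcq'⟩
end
end
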